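/- arXiv:math/0109024 — 2 statements merged into one kernel-verified Lean document; each statement's English description precedes it below -/
import Mathlib

section
/- Let n ≥ 1 be a natural number, λ, a₀ ∈ ℝ, and a : ℕ → ℝ a function with a(0) = a₀. Assume that for every real number t one has ∑_{m=0}^{2n} a(m)·t^m/m! = (1 + λt²)^n · a₀. Then for every k ≤ n one has (a(2k))^n = ((2k)! · C(n,k))^n · (a(2n)/(2n)!)^k · a₀^{n−k}. -/
open Finset

open Polynomial in
/-- The coefficients of `(1 + c X²)ⁿ` in even degree. -/
lemma coeff_one_add_C_mul_X_sq_pow {R : Type*} [CommSemiring R] (n k : ℕ) (c : R) :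
    ((1 + C c * X ^ 2) ^ n : R[X]).coeff (2 * k) = n.choose k * c ^ k := by
  have h : ((1 + C c * X ^ 2) ^ n : R[X])
      = expand R 2 (((1 + X) ^ n : R[X]).comp (C c * X)) := by simp
  rw [h, coeff_expand_mul' two_pos, comp_C_mul_X_coeff, coeff_one_add_X_pow]

open Polynomial in
/-- Comparison of even coefficients in `∑ a(m) t^m / m! = (1 + c t²)ⁿ b`. -/
lemma eq_factorial_mul_choose_of_sum_eq {K : Type*} [Field K] [CharZero K] {n : ℕ} {c b : K}
    {a : ℕ → K}
    (h : ∀ t : K, ∑ m ∈ Finset.range (2 * n + 1), a m * t ^ m / (m.factorial : K)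
      = (1 + c * t ^ 2) ^ n * b) {k : ℕ} (hk : k ≤ n) :
    a (2 * k) = (2 * k).factorial * n.choose k * (c ^ k * b) := by
  have hpoly : ∑ m ∈ Finset.range (2 * n + 1), C (a m / (m.factorial : K)) * X ^ m
      = (1 + C c * X ^ 2) ^ n * C b := by
    refine Polynomial.funext fun t => ?_
    simpa [eval_finsetSum, div_mul_eq_mul_div] using h t
  have hcoeff := congrArg (fun p => p.coeff (2 * k)) hpoly
  simp only [finsetSum_coeff, coeff_C_mul_X_pow, coeff_mul_C,
    coeff_one_add_C_mul_X_sq_pow] at hcoeff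
  rw [Finset.sum_ite_eq, if_pos (Finset.mem_range.2 (by omega)),
    div_eq_iff (Nat.cast_ne_zero.2 (Nat.factorial_ne_zero _))] at hcoeff
  rw [hcoeff]
  ring

/-- The algebraic identity behind the generalized Hitchin–Sawon formula: if
`∑_{m=0}^{2n} a(m) t^m / m! = (1 + λ t²)^n a₀` for all real `t`, then for `k ≤ n`
one has `a(2k)^n = ((2k)! C(n,k))^n (a(2n)/(2n)!)^k a₀^{n-k}`. -/
theorem stmt_4 (n : ℕ) (hn : 1 ≤ n) (lam a₀ : ℝ) (a : ℕ → ℝ) (ha₀ : a 0 = a₀)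
    (h : ∀ t : ℝ, ∑ m ∈ Finset.range (2 * n + 1), a m * t ^ m / (m.factorial : ℝ)
      = (1 + lam * t ^ 2) ^ n * a₀) :
    ∀ k ≤ n, (a (2 * k)) ^ n
      = (((2 * k).factorial : ℝ) * (n.choose k : ℝ)) ^ n
        * (a (2 * n) / ((2 * n).factorial : ℝ)) ^ k * a₀ ^ (n - k) := by
  intro k hk
  have htop : a (2 * n) / ((2 * n).factorial : ℝ) = lam ^ n * a₀ := by
    rw [div_eq_iff (Nat.cast_ne_zero.2 (Nat.factorial_ne_zero _)),
      eq_factorial_mul_choose_of_sum_eq h le_rfl, Nat.choose_self]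
    push_cast
    ring
  rw [htop, eq_factorial_mul_choose_of_sum_eq h hk, mul_pow _ (lam ^ k * a₀), mul_assoc]
  congr 1
  rw [mul_pow, mul_pow, mul_assoc, ← pow_add, Nat.add_sub_cancel' hk, ← pow_mul, ← pow_mul,
    mul_comm k n]
end

section
/- Let V be a finite-dimensional complex vector space with dim V ≥ 3, let B be a nondegenerate symmetric bilinear form on V, and let α ∈ V with B(α,α) ≠ 0. Suppose β ∈ V is such that every y ∈ V with B(y,y) = 0 and B(y,α) = 0 also satisfies B(y,β) = 0. Then β is a scalar multiple of α. -/
/-- A nonzero vector is paired nontrivially with some vector orthogonal to two given mutually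
orthogonal anisotropic vectors, provided it is itself orthogonal to them. -/
theorem exists_orthogonal_pair_apply_ne_zero {K V : Type*} [Field K] [AddCommGroup V] [Module K V]
    (B : LinearMap.BilinForm K V) (hsymm : ∀ x y : V, B x y = B y x)
    (hnd : ∀ v : V, (∀ w : V, B v w = 0) → v = 0)
    {a g u : V} (ha : B a a ≠ 0) (hg : B g g ≠ 0) (hga : B g a = 0)
    (hu : u ≠ 0) (hua : B u a = 0) (hug : B u g = 0) :
    ∃ w, B w a = 0 ∧ B w g = 0 ∧ B u w ≠ 0 := by
  obtain ⟨w, hw⟩ : ∃ w, B u w ≠ 0 := by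
    by_contra! h
    exact hu (hnd u h)
  have hag : B a g = 0 := by rw [hsymm, hga]
  refine ⟨w - (B w a / B a a) • a - (B w g / B g g) • g, ?_, ?_, ?_⟩
  · simp [hga, ha]
  · simp [hag, hg]
  · simpa [hua, hug] using hw

/-- In dimension at least three, some anisotropic vector is orthogonal to two given mutually
orthogonal anisotropic vectors. -/
theorem exists_anisotropic_orthogonal_pair {K V : Type*} [Field K] [NeZero (2 : K)]
    [AddCommGroup V] [Module K V] [FiniteDimensional K V] (hdim : 3 ≤ Module.finrank K V)
    (B : LinearMap.BilinForm K V) (hsymm : ∀ x y : V, B x y = B y x)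
    (hnd : ∀ v : V, (∀ w : V, B v w = 0) → v = 0)
    {a g : V} (ha : B a a ≠ 0) (hg : B g g ≠ 0) (hga : B g a = 0) :
    ∃ u, B u a = 0 ∧ B u g = 0 ∧ B u u ≠ 0 := by
  obtain ⟨u, hu, hu0⟩ : ∃ u ∈ LinearMap.ker ((B a).prod (B g)), u ≠ 0 := by
    refine Submodule.exists_mem_ne_zero_of_ne_bot (LinearMap.ker_ne_bot_of_finrank_lt ?_)
    rw [Module.finrank_prod, Module.finrank_self]
    omega
  obtain ⟨hau, hgu⟩ : B a u = 0 ∧ B g u = 0 := by simpa using hu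
  have hua : B u a = 0 := by rw [hsymm, hau]
  have hug : B u g = 0 := by rw [hsymm, hgu]
  by_cases huu : B u u = 0
  · obtain ⟨w, hwa, hwg, huw⟩ :=
      exists_orthogonal_pair_apply_ne_zero B hsymm hnd ha hg hga hu0 hua hug
    by_cases hww : B w w = 0
    · refine ⟨w + u, by simp [hwa, hua], by simp [hwg, hug], ?_⟩
      have h : B (w + u) (w + u) = 2 * B u w := by
        simp [huu, hww, hsymm w u, two_mul]
      rw [h]
      exact mul_ne_zero two_ne_zero huw
    · exact ⟨w, hwa, hwg, hww⟩
  · exact ⟨u, hua, hug, huu⟩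

/-- A nonzero vector orthogonal to an anisotropic vector `a` is paired nontrivially with some
isotropic vector orthogonal to `a`. -/
theorem exists_isotropic_orthogonal_apply_ne_zero {K V : Type*} [Field K] [IsAlgClosed K]
    [NeZero (2 : K)] [AddCommGroup V] [Module K V] [FiniteDimensional K V]
    (hdim : 3 ≤ Module.finrank K V)
    (B : LinearMap.BilinForm K V) (hsymm : ∀ x y : V, B x y = B y x)
    (hnd : ∀ v : V, (∀ w : V, B v w = 0) → v = 0)
    {a g : V} (ha : B a a ≠ 0) (hg : g ≠ 0) (hga : B g a = 0) :
    ∃ y, B y y = 0 ∧ B y a = 0 ∧ B y g ≠ 0 := by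
  by_cases hgg : B g g = 0
  · obtain ⟨w, hw⟩ : ∃ w, B g w ≠ 0 := by
      by_contra! h
      exact hg (hnd g h)
    obtain ⟨v, hva, hgv⟩ : ∃ v, B v a = 0 ∧ B g v ≠ 0 :=
      ⟨w - (B w a / B a a) • a, by simp [ha], by simpa [hga] using hw⟩
    refine ⟨v - (B v v / (2 * B g v)) • g, ?_, by simp [hva, hga], ?_⟩
    · have h2 : (2 : K) ≠ 0 := two_ne_zero
      simp only [map_sub, map_smul, LinearMap.sub_apply, LinearMap.smul_apply, smul_eq_mul,
        hsymm v g, hgg]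
      field_simp
      ring
    · simpa [hgg, hsymm v g] using hgv
  · obtain ⟨u, hua, hug, huu⟩ :=
      exists_anisotropic_orthogonal_pair hdim B hsymm hnd ha hgg hga
    obtain ⟨t, ht⟩ := IsAlgClosed.exists_pow_nat_eq (-(B u u / B g g)) (n := 2) (by norm_num)
    have ht0 : t ≠ 0 := by
      rintro rfl
      exact neg_ne_zero.mpr (div_ne_zero huu hgg) (by simpa using ht.symm)
    refine ⟨u + t • g, ?_, by simp [hua, hga], by simp [hug, ht0, hgg]⟩
    have h : B (u + t • g) (u + t • g) = B u u + t ^ 2 * B g g := by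
      simp [hug, hsymm g u]
      ring
    rw [h, ht]
    field_simp
    ring


/-- If `B` is a nondegenerate symmetric bilinear form on a complex vector space of
dimension at least 3 and `α` is anisotropic, then any vector `β` orthogonal to all
isotropic vectors orthogonal to `α` is a scalar multiple of `α`. -/
theorem stmt_8 {V : Type*} [AddCommGroup V] [Module ℂ V] [FiniteDimensional ℂ V]
    (hdim : 3 ≤ Module.finrank ℂ V)
    (B : LinearMap.BilinForm ℂ V) (hsymm : ∀ x y : V, B x y = B y x)
    (hnd : ∀ v : V, (∀ w : V, B v w = 0) → v = 0)
    (α : V) (hα : B α α ≠ 0) (β : V)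
    (hβ : ∀ y : V, B y y = 0 → B y α = 0 → B y β = 0) :
    ∃ c : ℂ, β = c • α := by
  by_contra! h
  obtain ⟨y, hyy, hya, hyg⟩ := exists_isotropic_orthogonal_apply_ne_zero hdim B hsymm hnd hα
    (sub_ne_zero.mpr (h (B β α / B α α))) (by simp [hα])
  exact hyg (by simp [hya, hβ y hyy hya])
end
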